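/- Let k = k(n) ≥ 4 be an integer with k ≤ n/(4·log₂ n). Then the formula ERPHP has a Sherali-Adams resolution refutation of size at most C·k^{k+2}·n^k for an absolute constant C, and there exist a constant c > 0 and an integer n₀ such that for all n ≥ n₀ every Sherali-Adams resolution refutation of ERPHP has size at least c · n^k / (k · (16/15)^k · (2k·log₂ n)^k). -/

import Mathlib

namespace NarrowProofs

open MvPolynomial

/-- A clause is a finite set of literals; a literal is a variable together with a
sign (`true` = positive literal, `false` = negative literal). -/
abbrev Clause (V : Type) := Finset (V × Bool)

/-- Twin-variable alphabet: `(v, false)` is the variable `v` itself and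
`(v, true)` is its twin `v̄` (intended value `1 − v`). -/
abbrev PV (V : Type) := V × Bool

/-- The expansion of one term of a Sherali-Adams style derivation:
`∏_{i∈I} x_i · ∏_{j∈J} (1−x_j) · p`. -/
noncomputable def expandTerm {σ : Type} (I J : Finset σ) (p : MvPolynomial σ ℝ) :
    MvPolynomial σ ℝ :=
  (∏ i ∈ I, X i) * (∏ j ∈ J, (1 - X j)) * p

/-- A Sherali-Adams style derivation of the inequality `r ≥ 0`, where each
`p_t` must come from the allowed set `Ax`: a formula
`∑_t α_t · ∏_{i∈I_t} x_i · ∏_{j∈J_t} (1−x_j) · p_t` with `α_t ≥ 0` that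
expands to the polynomial `r`. -/
structure SAStyleDeriv (σ : Type) (Ax : Set (MvPolynomial σ ℝ))
    (r : MvPolynomial σ ℝ) where
  len : ℕ
  α : Fin len → ℝ
  I : Fin len → Finset σ
  J : Fin len → Finset σ
  p : Fin len → MvPolynomial σ ℝ
  alpha_nonneg : ∀ t, 0 ≤ α t
  p_mem : ∀ t, p t ∈ Ax
  sums : ∑ t, α t • expandTerm (I t) (J t) (p t) = r

/-- The rank of the derivation is at most `d`: every expanded term has total
degree at most `d`. -/
def SAStyleDeriv.rankLE {σ : Type} {Ax : Set (MvPolynomial σ ℝ)}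
    {r : MvPolynomial σ ℝ} (der : SAStyleDeriv σ Ax r) (d : ℕ) : Prop :=
  ∀ t, (expandTerm (der.I t) (der.J t) (der.p t)).totalDegree ≤ d

/-- The size of the derivation: the total number of terms of the expanded
polynomials. -/
noncomputable def SAStyleDeriv.size {σ : Type} {Ax : Set (MvPolynomial σ ℝ)}
    {r : MvPolynomial σ ℝ} (der : SAStyleDeriv σ Ax r) : ℕ :=
  ∑ t, (expandTerm (der.I t) (der.J t) (der.p t)).support.card

/-- Boolean axioms `x²−x` and `x−x²`. -/
def boolAxioms (σ : Type) : Set (MvPolynomial σ ℝ) :=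
  {p | ∃ x : σ, p = X x ^ 2 - X x ∨ p = X x - X x ^ 2}

/-- The polynomials allowed in a Sherali-Adams derivation from hypotheses `Q`:
a hypothesis, a Boolean axiom, or the constant 1. -/
def SAAxioms (σ : Type) (Q : Set (MvPolynomial σ ℝ)) : Set (MvPolynomial σ ℝ) :=
  Q ∪ boolAxioms σ ∪ {1}

/-- Complementarity axioms `1−x−x̄` and `−1+x+x̄` for twin variables. -/
def compAxioms (V : Type) : Set (MvPolynomial (PV V) ℝ) :=
  {p | ∃ v : V, p = 1 - X (v, false) - X (v, true) ∨ p = -1 + X (v, false) + X (v, true)}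

/-- The polynomials allowed in a Sherali-Adams resolution (SAR) derivation
from hypotheses `Q`: additionally the complementarity axioms. -/
def SARAxioms (V : Type) (Q : Set (MvPolynomial (PV V) ℝ)) :
    Set (MvPolynomial (PV V) ℝ) :=
  SAAxioms (PV V) Q ∪ compAxioms V

/-- The variables of the 3-CNF relativized pigeonhole principle `ERPHP`. -/
inductive ERVar where
  | p (u v : ℕ)
  | q (v w : ℕ)
  | r (v : ℕ)
  | rr (v v' : ℕ)
  | y (u v : ℕ)
  | z (v w : ℕ)
deriving DecidableEq

/-- The 3-CNF relativized pigeonhole principle formula with `k` pigeons chosen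
among `n` and `k-1` holes (all indices are 1-based). -/
def ERPHP (n k : ℕ) : Set (Clause ERVar) :=
  { C |
    (∃ u, 1 ≤ u ∧ u ≤ k ∧
      C = {(ERVar.p u 1, true), (ERVar.p u 2, true), (ERVar.y u 2, true)}) ∨
    (∃ u v, 1 ≤ u ∧ u ≤ k ∧ 2 ≤ v ∧ v ≤ n - 3 ∧
      C = {(ERVar.y u v, false), (ERVar.p u (v+1), true), (ERVar.y u (v+1), true)}) ∨
    (∃ u, 1 ≤ u ∧ u ≤ k ∧
      C = {(ERVar.y u (n-2), false), (ERVar.p u (n-1), true), (ERVar.p u n, true)}) ∨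
    (∃ v, 1 ≤ v ∧ v ≤ n ∧
      C = {(ERVar.r v, false), (ERVar.q v 1, true), (ERVar.z v 1, true)}) ∨
    (∃ v w, 1 ≤ v ∧ v ≤ n ∧ 1 ≤ w ∧ w ≤ k - 4 ∧
      C = {(ERVar.z v w, false), (ERVar.q v (w+1), true), (ERVar.z v (w+1), true)}) ∨
    (∃ v, 1 ≤ v ∧ v ≤ n ∧
      C = {(ERVar.z v (k-3), false), (ERVar.q v (k-2), true), (ERVar.q v (k-1), true)}) ∨
    (∃ u u' v, 1 ≤ u ∧ u ≤ k ∧ 1 ≤ u' ∧ u' ≤ k ∧ u ≠ u' ∧ 1 ≤ v ∧ v ≤ n ∧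
      C = {(ERVar.p u v, false), (ERVar.p u' v, false)}) ∨
    (∃ u v, 1 ≤ u ∧ u ≤ k ∧ 1 ≤ v ∧ v ≤ n ∧
      C = {(ERVar.p u v, false), (ERVar.r v, true)}) ∨
    (∃ v v', 1 ≤ v ∧ v ≤ n ∧ 1 ≤ v' ∧ v' ≤ n ∧ v ≠ v' ∧
      C = {(ERVar.r v, false), (ERVar.r v', false), (ERVar.rr v v', true)}) ∨
    (∃ v v' w, 1 ≤ v ∧ v ≤ n ∧ 1 ≤ v' ∧ v' ≤ n ∧ v ≠ v' ∧ 1 ≤ w ∧ w ≤ k - 1 ∧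
      C = {(ERVar.rr v v', false), (ERVar.q v w, false), (ERVar.q v' w, false)}) }

/-- The SAR encoding (truth = 1, with twin variables) of a clause:
`∑_{i∈I} x_i + ∑_{j∈J} x̄_j − 1`. -/
noncomputable def encodeIneqSAR {V : Type} [DecidableEq V] (C : Clause V) :
    MvPolynomial (PV V) ℝ :=
  (∑ l ∈ C, X (l.1, !l.2)) - 1

section Upper

/-- derivability with a size bound -/
def Der {σ : Type} (Ax : Set (MvPolynomial σ ℝ)) (r : MvPolynomial σ ℝ) (s : ℕ) : Prop :=
  ∃ d : SAStyleDeriv σ Ax r, d.size ≤ s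

/-- the multilinear monomial of a set of variables -/
noncomputable def Mo {σ : Type} (S : Finset σ) : MvPolynomial σ ℝ := ∏ i ∈ S, X i

theorem Der.mono {σ : Type} {Ax : Set (MvPolynomial σ ℝ)} {r : MvPolynomial σ ℝ} {s s' : ℕ}
    (h : Der Ax r s) (hs : s ≤ s') : Der Ax r s' := by
  obtain ⟨d, hd⟩ := h
  exact ⟨d, hd.trans hs⟩

theorem Der.congr {σ : Type} {Ax : Set (MvPolynomial σ ℝ)} {r r' : MvPolynomial σ ℝ} {s s' : ℕ}
    (h : Der Ax r s) (hr : r = r') (hs : s ≤ s') : Der Ax r' s' := by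
  subst hr
  exact h.mono hs

theorem Der.zero {σ : Type} {Ax : Set (MvPolynomial σ ℝ)} : Der Ax (0 : MvPolynomial σ ℝ) 0 := by
  refine ⟨⟨0, Fin.elim0, Fin.elim0, Fin.elim0, Fin.elim0, fun t => t.elim0, fun t => t.elim0, ?_⟩, ?_⟩
  · simp
  · simp [SAStyleDeriv.size]

theorem Der.add {σ : Type} {Ax : Set (MvPolynomial σ ℝ)} {r r' : MvPolynomial σ ℝ} {s s' : ℕ}
    (h : Der Ax r s) (h' : Der Ax r' s') : Der Ax (r + r') (s + s') := by
  obtain ⟨d, hd⟩ := h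
  obtain ⟨d', hd'⟩ := h'
  refine ⟨⟨d.len + d'.len, Fin.append d.α d'.α, Fin.append d.I d'.I, Fin.append d.J d'.J,
    Fin.append d.p d'.p, ?_, ?_, ?_⟩, ?_⟩
  · intro t
    refine Fin.addCases (fun i => ?_) (fun i => ?_) t
    · simpa using d.alpha_nonneg i
    · simpa using d'.alpha_nonneg i
  · intro t
    refine Fin.addCases (fun i => ?_) (fun i => ?_) t
    · simpa using d.p_mem i
    · simpa using d'.p_mem i
  · rw [Fin.sum_univ_add]
    simp only [Fin.append_left, Fin.append_right]
    rw [d.sums, d'.sums]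
  · unfold SAStyleDeriv.size at *
    simp only
    rw [Fin.sum_univ_add]
    simp only [Fin.append_left, Fin.append_right]
    omega

theorem Der.sum {σ ι : Type} {Ax : Set (MvPolynomial σ ℝ)} (A : Finset ι)
    (r : ι → MvPolynomial σ ℝ) (s : ℕ) (h : ∀ i ∈ A, Der Ax (r i) s) :
    Der Ax (∑ i ∈ A, r i) (A.card * s) := by
  classical
  induction A using Finset.induction_on with
  | empty => simpa using Der.zero
  | insert a A ha ih =>
    rw [Finset.sum_insert ha, Finset.card_insert_of_notMem ha]
    refine (Der.add (h a (Finset.mem_insert_self _ _))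
      (ih fun i hi => h i (Finset.mem_insert_of_mem hi))).mono ?_
    rw [add_mul, one_mul, add_comm]

theorem card_supp_mul {σ : Type} (p q : MvPolynomial σ ℝ) :
    (p * q).support.card ≤ p.support.card * q.support.card := by
  classical
  exact (Finset.card_le_card (MvPolynomial.support_mul p q)).trans Finset.card_add_le

theorem card_supp_add {σ : Type} (p q : MvPolynomial σ ℝ) :
    (p + q).support.card ≤ p.support.card + q.support.card := by
  classical
  exact (Finset.card_le_card MvPolynomial.support_add).trans (Finset.card_union_le _ _)

theorem card_supp_neg {σ : Type} (p : MvPolynomial σ ℝ) :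
    (-p).support.card = p.support.card := by
  rw [MvPolynomial.support_neg]

theorem card_supp_sub {σ : Type} (p q : MvPolynomial σ ℝ) :
    (p - q).support.card ≤ p.support.card + q.support.card := by
  rw [sub_eq_add_neg, ← card_supp_neg q]
  exact card_supp_add _ _

theorem card_supp_X {σ : Type} (i : σ) : (X i : MvPolynomial σ ℝ).support.card = 1 := by
  classical
  rw [MvPolynomial.support_X]; simp

theorem card_supp_one {σ : Type} : (1 : MvPolynomial σ ℝ).support.card ≤ 1 := by
  classical
  rw [show (1 : MvPolynomial σ ℝ) = monomial 0 1 from rfl]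
  exact (Finset.card_le_card MvPolynomial.support_monomial_subset).trans (by simp)

theorem card_supp_Mo {σ : Type} (S : Finset σ) : (Mo S).support.card ≤ 1 := by
  classical
  unfold Mo
  induction S using Finset.induction_on with
  | empty => simp
  | insert a A ha ih =>
    rw [Finset.prod_insert ha]
    refine (card_supp_mul _ _).trans ?_
    rw [card_supp_X]; omega

theorem Der.base {σ : Type} {Ax : Set (MvPolynomial σ ℝ)} {p : MvPolynomial σ ℝ} (S : Finset σ)
    (hp : p ∈ Ax) (s : ℕ) (hs : p.support.card ≤ s) : Der Ax (Mo S * p) s := by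
  refine ⟨⟨1, fun _ => 1, fun _ => S, fun _ => ∅, fun _ => p, by simp, by simpa using hp, ?_⟩, ?_⟩
  · simp [expandTerm, Mo]
  · simp only [SAStyleDeriv.size, expandTerm, Finset.prod_empty, mul_one, Finset.univ_unique,
      Finset.sum_singleton]
    refine (card_supp_mul _ _).trans ?_
    have := card_supp_Mo S
    unfold Mo at this
    nlinarith

variable {V : Type} [DecidableEq V] {Q : Set (MvPolynomial (PV V) ℝ)}

theorem Mo_insert (S : Finset (PV V)) (x : PV V) (hx : x ∉ S) :
    Mo (insert x S) = Mo S * X x := by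
  unfold Mo
  rw [Finset.prod_insert hx, mul_comm]

theorem Der.comp (S : Finset (PV V)) (v : V) :
    Der (SARAxioms V Q) (Mo S * (1 - X (v, false) - X (v, true))) 3 := by
  refine Der.base S (Or.inr ⟨v, Or.inl rfl⟩) 3 ?_
  refine (card_supp_sub _ _).trans ?_
  have := card_supp_sub (1 : MvPolynomial (PV V) ℝ) (X (v, false))
  have := card_supp_one (σ := PV V)
  simp only [card_supp_X] at *
  omega

theorem Der.self (S : Finset (PV V)) (x : PV V) (hx : x ∈ S) :
    Der (SARAxioms V Q) (Mo S * (X x - 1)) 2 := by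
  have h : Der (SARAxioms V Q) (Mo (S.erase x) * (X x ^ 2 - X x)) 2 := by
    refine Der.base _ (Or.inl (Or.inl (Or.inr ⟨x, Or.inl rfl⟩))) 2 ?_
    refine (card_supp_sub _ _).trans ?_
    have := card_supp_mul (X x : MvPolynomial (PV V) ℝ) (X x)
    rw [sq]
    simp only [card_supp_X] at *
    omega
  refine h.congr ?_ le_rfl
  have h2 := Mo_insert (S.erase x) x (by simp)
  rw [Finset.insert_erase hx] at h2
  rw [h2]; ring

theorem Der.negTwin (S : Finset (PV V)) (v : V) (hx : (v, false) ∈ S) :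
    Der (SARAxioms V Q) (Mo S * (- X (v, true))) 5 := by
  refine ((Der.self S _ hx).add (Der.comp S v)).congr ?_ le_rfl
  ring

theorem Der.clause {F : Set (Clause V)} (S : Finset (PV V)) (C : Clause V) (hC : C ∈ F)
    (hc : C.card ≤ 3) :
    Der (SARAxioms V ((fun C => encodeIneqSAR C) '' F)) (Mo S * encodeIneqSAR C) 4 := by
  refine Der.base S (Or.inl (Or.inl (Or.inl ⟨C, hC, rfl⟩))) 4 ?_
  unfold encodeIneqSAR
  refine (card_supp_sub _ _).trans ?_
  have h1 := card_supp_one (σ := PV V)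
  have h2 : (∑ l ∈ C, X (l.1, !l.2) : MvPolynomial (PV V) ℝ).support.card ≤ C.card := by
    clear hC hc
    induction C using Finset.induction_on with
    | empty => simp
    | insert a A ha ih =>
      rw [Finset.sum_insert ha, Finset.card_insert_of_notMem ha]
      refine (card_supp_add _ _).trans ?_
      rw [card_supp_X]; omega
  omega

end Upper

section Upper2

variable {n k : ℕ}

/-- the axioms for ERPHP -/
abbrev AxE (n k : ℕ) : Set (MvPolynomial (PV ERVar) ℝ) :=
  SARAxioms ERVar ((fun C => encodeIneqSAR C) '' ERPHP n k)

theorem Der.chainP (hn : 4 ≤ n) (S : Finset (PV ERVar)) (u : ℕ) (h1 : 1 ≤ u) (h2 : u ≤ k) :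
    Der (AxE n k) (Mo S * ((∑ v ∈ Finset.Icc 1 n, X (ERVar.p u v, false)) - 1)) (7 * n) := by
  have key : ∀ j, 2 ≤ j → j ≤ n - 2 → Der (AxE n k) (Mo S *
      ((∑ v ∈ Finset.Icc 1 j, X (ERVar.p u v, false)) + X (ERVar.y u j, false) - 1)) (7 * j) := by
    intro j hj
    induction j, hj using Nat.le_induction with
    | base =>
      intro _
      refine (Der.clause (F := ERPHP n k) S
        {(ERVar.p u 1, true), (ERVar.p u 2, true), (ERVar.y u 2, true)}
        (Or.inl ⟨u, h1, h2, rfl⟩) Finset.card_le_three).congr ?_ (by omega)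
      rw [show Finset.Icc 1 2 = {1, 2} from rfl]
      simp [encodeIneqSAR]
      left
      ring
    | succ j hj ih =>
      intro hj2
      refine (((ih (by omega)).add (Der.clause (F := ERPHP n k) S
        {(ERVar.y u j, false), (ERVar.p u (j+1), true), (ERVar.y u (j+1), true)}
        (Or.inr (Or.inl ⟨u, j, h1, h2, hj, by omega, rfl⟩)) Finset.card_le_three)).add
        (Der.comp S (ERVar.y u j))).congr ?_ (by omega)
      rw [Finset.sum_Icc_succ_top (by omega)]
      simp [encodeIneqSAR]
      ring
  refine (((key (n-2) (by omega) le_rfl).add (Der.clause (F := ERPHP n k) S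
        {(ERVar.y u (n-2), false), (ERVar.p u (n-1), true), (ERVar.p u n, true)}
        (Or.inr (Or.inr (Or.inl ⟨u, h1, h2, rfl⟩))) Finset.card_le_three)).add
        (Der.comp S (ERVar.y u (n-2)))).congr ?_ (by omega)
  obtain ⟨m, rfl⟩ : ∃ m, n = m + 2 := ⟨n - 2, by omega⟩
  simp only [show m + 2 - 2 = m by omega, show m + 2 - 1 = m + 1 by omega]
  rw [Finset.sum_Icc_succ_top (by omega), Finset.sum_Icc_succ_top (by omega)]
  simp [encodeIneqSAR]
  ring

theorem Der.chainQ (hk : 4 ≤ k) (S : Finset (PV ERVar)) (v : ℕ) (h1 : 1 ≤ v) (h2 : v ≤ n) :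
    Der (AxE n k) (Mo S * (X (ERVar.r v, true) +
      (∑ w ∈ Finset.Icc 1 (k-1), X (ERVar.q v w, false)) - 1)) (7 * k) := by
  have key : ∀ j, 1 ≤ j → j ≤ k - 3 → Der (AxE n k) (Mo S * (X (ERVar.r v, true) +
      (∑ w ∈ Finset.Icc 1 j, X (ERVar.q v w, false)) + X (ERVar.z v j, false) - 1)) (7 * j) := by
    intro j hj
    induction j, hj using Nat.le_induction with
    | base =>
      intro _
      refine (Der.clause (F := ERPHP n k) S
        {(ERVar.r v, false), (ERVar.q v 1, true), (ERVar.z v 1, true)}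
        (Or.inr (Or.inr (Or.inr (Or.inl ⟨v, h1, h2, rfl⟩)))) Finset.card_le_three).congr
          ?_ (by omega)
      rw [show Finset.Icc 1 1 = {1} from rfl]
      simp [encodeIneqSAR]
      left
      ring
    | succ j hj ih =>
      intro hj2
      refine (((ih (by omega)).add (Der.clause (F := ERPHP n k) S
        {(ERVar.z v j, false), (ERVar.q v (j+1), true), (ERVar.z v (j+1), true)}
        (Or.inr (Or.inr (Or.inr (Or.inr (Or.inl ⟨v, j, h1, h2, hj, by omega, rfl⟩)))))
        Finset.card_le_three)).add
        (Der.comp S (ERVar.z v j))).congr ?_ (by omega)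
      rw [Finset.sum_Icc_succ_top (by omega)]
      simp [encodeIneqSAR]
      ring
  refine (((key (k-3) (by omega) le_rfl).add (Der.clause (F := ERPHP n k) S
        {(ERVar.z v (k-3), false), (ERVar.q v (k-2), true), (ERVar.q v (k-1), true)}
        (Or.inr (Or.inr (Or.inr (Or.inr (Or.inr (Or.inl ⟨v, h1, h2, rfl⟩))))))
        Finset.card_le_three)).add
        (Der.comp S (ERVar.z v (k-3)))).congr ?_ (by omega)
  obtain ⟨m, rfl⟩ : ∃ m, k = m + 3 := ⟨k - 3, by omega⟩
  simp only [show m + 3 - 3 = m by omega, show m + 3 - 2 = m + 1 by omega,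
    show m + 3 - 1 = m + 1 + 1 by omega]
  rw [Finset.sum_Icc_succ_top (by omega), Finset.sum_Icc_succ_top (by omega)]
  simp [encodeIneqSAR]
  ring

theorem Der.leafP (S : Finset (PV ERVar)) (u u' v : ℕ) (h1 : 1 ≤ u) (h2 : u ≤ k)
    (h1' : 1 ≤ u') (h2' : u' ≤ k) (hne : u ≠ u') (h3 : 1 ≤ v) (h4 : v ≤ n)
    (m : (ERVar.p u v, false) ∈ S) (m' : (ERVar.p u' v, false) ∈ S) :
    Der (AxE n k) (- Mo S) 45 := by
  refine (((Der.clause (F := ERPHP n k) S {(ERVar.p u v, false), (ERVar.p u' v, false)}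
    (by
      right; right; right; right; right; right; left
      exact ⟨u, u', v, h1, h2, h1', h2', hne, h3, h4, rfl⟩)
    (Finset.card_le_two.trans (by omega))).add (Der.negTwin S _ m)).add
    (Der.negTwin S _ m')).congr ?_ (by omega)
  simp [encodeIneqSAR, hne]
  ring

theorem Der.negR (S : Finset (PV ERVar)) (u v : ℕ) (h1 : 1 ≤ u) (h2 : u ≤ k)
    (h3 : 1 ≤ v) (h4 : v ≤ n) (m : (ERVar.p u v, false) ∈ S) :
    Der (AxE n k) (Mo S * (- X (ERVar.r v, true))) 12 := by
  refine (((Der.clause (F := ERPHP n k) S {(ERVar.p u v, false), (ERVar.r v, true)}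
    (by
      right; right; right; right; right; right; right; left
      exact ⟨u, v, h1, h2, h3, h4, rfl⟩)
    (Finset.card_le_two.trans (by omega))).add (Der.negTwin S _ m)).add
    (Der.comp S (ERVar.r v))).congr ?_ (by omega)
  simp [encodeIneqSAR]
  ring

theorem Der.leafQ (S : Finset (PV ERVar)) (u u' v v' w : ℕ) (h1 : 1 ≤ u) (h2 : u ≤ k)
    (h1' : 1 ≤ u') (h2' : u' ≤ k) (hne : v ≠ v') (h3 : 1 ≤ v) (h4 : v ≤ n)
    (h3' : 1 ≤ v') (h4' : v' ≤ n) (h5 : 1 ≤ w) (h6 : w ≤ k - 1)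
    (m : (ERVar.p u v, false) ∈ S) (m' : (ERVar.p u' v', false) ∈ S)
    (l : (ERVar.q v w, false) ∈ S) (l' : (ERVar.q v' w, false) ∈ S) :
    Der (AxE n k) (- Mo S) 45 := by
  have a1 := Der.clause (F := ERPHP n k) S
    {(ERVar.r v, false), (ERVar.r v', false), (ERVar.rr v v', true)}
    (by
      right; right; right; right; right; right; right; right; left
      exact ⟨v, v', h3, h4, h3', h4', hne, rfl⟩) Finset.card_le_three
  have a2 := Der.clause (F := ERPHP n k) S
    {(ERVar.rr v v', false), (ERVar.q v w, false), (ERVar.q v' w, false)}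
    (by
      right; right; right; right; right; right; right; right; right
      exact ⟨v, v', w, h3, h4, h3', h4', hne, h5, h6, rfl⟩) Finset.card_le_three
  refine ((((((a1.add a2).add (Der.negR S u v h1 h2 h3 h4 m)).add
    (Der.negR S u' v' h1' h2' h3' h4' m')).add (Der.negTwin S _ l)).add
    (Der.negTwin S _ l')).add (Der.comp S (ERVar.rr v v'))).congr ?_ (by omega)
  simp [encodeIneqSAR, hne]
  ring

/-- path monomial, pigeon part -/
def SP (f : ℕ → ℕ) (i : ℕ) : Finset (PV ERVar) :=
  (Finset.Icc 1 i).image fun u => (ERVar.p u (f u), false)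

/-- path monomial, hole part -/
def SQ (f g : ℕ → ℕ) (i : ℕ) : Finset (PV ERVar) :=
  (Finset.Icc 1 i).image fun u => (ERVar.q (f u) (g u), false)

theorem SP_succ (f : ℕ → ℕ) (i v : ℕ) : SP (Function.update f (i+1) v) (i+1) =
    insert (ERVar.p (i+1) v, false) (SP f i) := by
  unfold SP
  rw [← Finset.insert_Icc_right_eq_Icc_add_one (by omega), Finset.image_insert]
  congr 1
  · simp
  · apply Finset.image_congr
    intro u hu
    have : u ≠ i + 1 := by
      simp at hu; omega
    simp [Function.update_of_ne this]

theorem SQ_succ (f g : ℕ → ℕ) (i w : ℕ) : SQ f (Function.update g (i+1) w) (i+1) =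
    insert (ERVar.q (f (i+1)) w, false) (SQ f g i) := by
  unfold SQ
  rw [← Finset.insert_Icc_right_eq_Icc_add_one (by omega), Finset.image_insert]
  congr 1
  · simp
  · apply Finset.image_congr
    intro u hu
    have : u ≠ i + 1 := by
      simp at hu; omega
    simp [Function.update_of_ne this]

theorem treeQ (hk : 4 ≤ k) (f : ℕ → ℕ) (hf : ∀ u, 1 ≤ u → u ≤ k → 1 ≤ f u ∧ f u ≤ n)
    (hinj : ∀ u u', 1 ≤ u → u ≤ k → 1 ≤ u' → u' ≤ k → f u = f u' → u = u') :
    ∀ j, j ≤ k → ∀ g : ℕ → ℕ, (∀ u, 1 ≤ u → u ≤ k - j → 1 ≤ g u ∧ g u ≤ k - 1) →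
    ∃ s, s + 20 ≤ 65 * k ^ j ∧ Der (AxE n k) (- Mo (SP f k ∪ SQ f g (k - j))) s := by
  intro j
  induction j with
  | zero =>
    intro _ g hg
    refine ⟨45, by simp, ?_⟩
    obtain ⟨u, hu, u', hu', hne, he⟩ := Finset.exists_ne_map_eq_of_card_lt_of_maps_to
      (s := Finset.Icc 1 k) (t := Finset.Icc 1 (k-1)) (f := g) (by simp; omega)
      (by
        intro u hu
        simp at hu ⊢
        exact hg u hu.1 (by omega))
    simp at hu hu'
    have e1 := hf u hu.1 hu.2
    have e2 := hf u' hu'.1 hu'.2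
    have e3 := hg u hu.1 (by omega)
    refine Der.leafQ _ u u' (f u) (f u') (g u) hu.1 hu.2 hu'.1 hu'.2 ?_ e1.1 e1.2 e2.1 e2.2
      e3.1 e3.2 ?_ ?_ ?_ ?_
    · intro h
      exact hne (hinj u u' hu.1 hu.2 hu'.1 hu'.2 h)
    · exact Finset.mem_union_left _ (Finset.mem_image.2 ⟨u, by simpa using hu, rfl⟩)
    · exact Finset.mem_union_left _ (Finset.mem_image.2 ⟨u', by simpa using hu', rfl⟩)
    · exact Finset.mem_union_right _ (Finset.mem_image.2 ⟨u, by simpa using hu, rfl⟩)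
    · exact Finset.mem_union_right _ (Finset.mem_image.2 ⟨u', by simpa using hu', by simp [he]⟩)
  | succ j ih =>
    intro hj g hg
    set i := k - (j+1) with hi
    have hi' : k - j = i + 1 := by omega
    rw [hi'] at ih
    have hs : ∀ w ∈ Finset.Icc 1 (k-1), Der (AxE n k)
        (Mo (SP f k ∪ SQ f g i) * (- X (ERVar.q (f (i+1)) w, false))) (65 * k ^ j - 20) := by
      intro w hw
      simp at hw
      obtain ⟨s, hs, hd⟩ := ih (by omega) (Function.update g (i+1) w) (by
        intro u h1 h2
        by_cases hu : u = i + 1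
        · subst hu; simpa using hw
        · rw [Function.update_of_ne hu]
          exact hg u h1 (by omega))
      refine hd.congr ?_ (by omega)
      rw [SQ_succ, Finset.union_insert, Mo_insert]
      · ring
      · intro h
        rcases Finset.mem_union.1 h with h | h
        · simp [SP] at h
        · obtain ⟨u, hu, hu2⟩ := Finset.mem_image.1 h
          simp at hu hu2
          have := hinj u (i+1) hu.1 (by omega) (by omega) (by omega) hu2.1
          omega
    have e1 := hf (i+1) (by omega) (by omega)
    have hR := Der.negR (n := n) (k := k) (SP f k ∪ SQ f g i) (i+1) (f (i+1)) (by omega)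
      (by omega) e1.1 e1.2
      (Finset.mem_union_left _ (Finset.mem_image.2 ⟨i+1, by simp; omega, rfl⟩))
    have hc := Der.chainQ (n := n) hk (SP f k ∪ SQ f g i) (f (i+1)) e1.1 e1.2
    refine ⟨7 * k + 12 + (k-1) * (65 * k ^ j - 20), ?_, ?_⟩
    · have hp : 0 < k ^ j := by positivity
      obtain ⟨a, ha⟩ : ∃ a, 65 * k ^ j = a + 20 := ⟨65 * k ^ j - 20, by omega⟩
      obtain ⟨b, rfl⟩ : ∃ b, k = b + 1 := ⟨k - 1, by omega⟩
      have : 65 * (b+1) ^ (j+1) = (a + 20) * (b+1) := by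
        rw [pow_succ, ← mul_assoc, ha]
      rw [this, ha]
      simp only [Nat.add_sub_cancel]
      nlinarith
    · refine ((hc.add hR).add (Der.sum _ _ _ hs)).congr ?_ (by simp)
      rw [← Finset.mul_sum, Finset.sum_neg_distrib]
      ring

theorem treeP (hn : 4 ≤ n) (hk : 4 ≤ k) :
    ∀ j, j ≤ k → ∀ f : ℕ → ℕ, (∀ u, 1 ≤ u → u ≤ k - j → 1 ≤ f u ∧ f u ≤ n) →
    ∃ s, s + 14 ≤ (65 * k ^ k) * n ^ j ∧ Der (AxE n k) (- Mo (SP f (k - j))) s := by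
  intro j
  induction j with
  | zero =>
    intro _ f hf
    have hp : 0 < k ^ k := by positivity
    by_cases hinj : ∀ u u', 1 ≤ u → u ≤ k → 1 ≤ u' → u' ≤ k → f u = f u' → u = u'
    · obtain ⟨s, hs, hd⟩ := treeQ (n := n) hk f (by simpa using hf) hinj k le_rfl (fun _ => 0)
        (by intro u h1 h2; omega)
      refine ⟨s, by simp; omega, hd.congr ?_ le_rfl⟩
      simp [SQ]
    · push Not at hinj
      obtain ⟨u, u', h1, h2, h3, h4, h5, h6⟩ := hinj
      have e1 := hf u h1 (by omega)
      refine ⟨45, by simp; omega, Der.leafP _ u u' (f u) h1 h2 h3 h4 h6 e1.1 e1.2 ?_ ?_⟩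
      · exact Finset.mem_image.2 ⟨u, by simpa using ⟨h1, h2⟩, rfl⟩
      · exact Finset.mem_image.2 ⟨u', by simpa using ⟨h3, h4⟩, by rw [h5]⟩
  | succ j ih =>
    intro hj f hf
    set i := k - (j+1) with hi
    have hi' : k - j = i + 1 := by omega
    rw [hi'] at ih
    have hs : ∀ v ∈ Finset.Icc 1 n, Der (AxE n k)
        (Mo (SP f i) * (- X (ERVar.p (i+1) v, false))) ((65 * k ^ k) * n ^ j - 14) := by
      intro v hv
      simp at hv
      obtain ⟨s, hs, hd⟩ := ih (by omega) (Function.update f (i+1) v) (by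
        intro u h1 h2
        by_cases hu : u = i + 1
        · subst hu; simpa using hv
        · rw [Function.update_of_ne hu]
          exact hf u h1 (by omega))
      refine hd.congr ?_ (by omega)
      rw [SP_succ, Mo_insert]
      · ring
      · intro h
        obtain ⟨u, hu, hu2⟩ := Finset.mem_image.1 h
        simp at hu hu2
        omega
    have hc := Der.chainP (k := k) hn (SP f i) (i+1) (by omega) (by omega)
    refine ⟨7 * n + n * ((65 * k ^ k) * n ^ j - 14), ?_, ?_⟩
    · have hp : 0 < k ^ k * n ^ j := by positivity
      obtain ⟨a, ha⟩ : ∃ a, (65 * k ^ k) * n ^ j = a + 14 :=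
        ⟨(65 * k ^ k) * n ^ j - 14, by rw [mul_assoc]; omega⟩
      have : (65 * k ^ k) * n ^ (j+1) = (a + 14) * n := by
        rw [pow_succ, ← mul_assoc, ha]
      rw [this, ha]
      simp only [Nat.add_sub_cancel]
      nlinarith
    · refine (hc.add (Der.sum _ _ _ hs)).congr ?_ (by simp)
      rw [← Finset.mul_sum, Finset.sum_neg_distrib]
      ring

theorem upper_bound (hn : 4 ≤ n) (hk : 4 ≤ k) :
    ∃ d : SAStyleDeriv (PV ERVar)
          (SARAxioms ERVar ((fun C => encodeIneqSAR C) '' ERPHP n k)) (-1),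
        d.size ≤ 65 * k ^ (k + 2) * n ^ k := by
  obtain ⟨s, hs, hd⟩ := treeP (n := n) (k := k) hn hk k le_rfl (fun _ => 0)
    (by intro u h1 h2; omega)
  refine hd.congr (by simp [SP, Mo]) ?_
  have : k ^ k ≤ k ^ (k+2) := Nat.pow_le_pow_right (by omega) (by omega)
  have : 65 * k ^ k * n ^ k ≤ 65 * k ^ (k+2) * n ^ k := by gcongr
  omega

end Upper2

section Lower

variable {n k : ℕ}

/-- the random restriction, extended by a placement `τ` of the chosen pigeons -/
def asg (e : Fin k ↪ Fin n) (b : Fin n → Bool) (τ : Equiv.Perm (Fin k)) : ERVar → Prop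
  | .p u v => ∃ i, i.val + 1 = u ∧ (e i).val + 1 = v
  | .y u v => ∃ i, i.val + 1 = u ∧ v < (e i).val + 1
  | .r v => ∃ i, (e i).val + 1 = v
  | .rr v v' => (∃ i, (e i).val + 1 = v) ∧ (∃ i, (e i).val + 1 = v')
  | .q v w => (∃ i, (e i).val + 1 = v ∧ (τ i).val = w) ∨
      (∃ x : Fin n, x.val + 1 = v ∧ (∀ i, e i ≠ x) ∧ b x = true)
  | .z v w => (∃ i, (e i).val + 1 = v ∧ w < (τ i).val) ∨
      (∃ x : Fin n, x.val + 1 = v ∧ (∀ i, e i ≠ x) ∧ b x = true)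

/-- the element of `[n]` a hole variable talks about -/
def ment : ERVar → Fin n → Prop
  | .q v _, x => x.val + 1 = v
  | .z v _, x => x.val + 1 = v
  | _, _ => False

open Classical in
/-- the 0/1 point of an assignment -/
noncomputable def pt (A : ERVar → Prop) (x : PV ERVar) : ℝ :=
  if (A x.1 ↔ x.2 = false) then 1 else 0

theorem pt_01 (A : ERVar → Prop) (x : PV ERVar) : pt A x = 0 ∨ pt A x = 1 := by
  unfold pt; split_ifs <;> simp

theorem pt_nonneg (A : ERVar → Prop) (x : PV ERVar) : 0 ≤ pt A x := by
  rcases pt_01 A x with h | h <;> simp [h]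

theorem pt_twin (A : ERVar → Prop) (v : ERVar) : pt A (v, false) + pt A (v, true) = 1 := by
  unfold pt
  by_cases h : A v <;> simp [h]

theorem asg_congr (e : Fin k ↪ Fin n) (b : Fin n → Bool) (τ τ' : Equiv.Perm (Fin k)) (x : ERVar)
    (h : ∀ i, ment x (e i) → τ i = τ' i) : asg e b τ x ↔ asg e b τ' x := by
  cases x with
  | p u v => rfl
  | y u v => rfl
  | r v => rfl
  | rr v v' => rfl
  | q v w =>
    simp only [asg]
    refine or_congr (exists_congr fun i => and_congr_right fun hi => ?_) Iff.rfl
    rw [h i hi]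
  | z v w =>
    simp only [asg]
    refine or_congr (exists_congr fun i => and_congr_right fun hi => ?_) Iff.rfl
    rw [h i hi]

theorem pt_congr (e : Fin k ↪ Fin n) (b : Fin n → Bool) (τ τ' : Equiv.Perm (Fin k)) (x : PV ERVar)
    (h : ∀ i, ment x.1 (e i) → τ i = τ' i) : pt (asg e b τ) x = pt (asg e b τ') x := by
  unfold pt
  rw [asg_congr e b τ τ' x.1 h]

theorem asg_free (e : Fin k ↪ Fin n) (b : Fin n → Bool) (τ : Equiv.Perm (Fin k)) (x : ERVar)
    (v : Fin n) (hv : ment x v) (h : ∀ i, e i ≠ v) : asg e b τ x ↔ b v = true := by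
  have aux : ∀ (P : Fin k → Prop), ((∃ i, (e i).val + 1 = v.val + 1 ∧ P i) ∨
      (∃ x : Fin n, x.val + 1 = v.val + 1 ∧ (∀ i, e i ≠ x) ∧ b x = true)) ↔ b v = true := by
    intro P
    constructor
    · rintro (⟨i, hi, _⟩ | ⟨x, hx, _, hb⟩)
      · exact absurd (Fin.ext (by omega)) (h i)
      · obtain rfl : x = v := Fin.ext (by omega)
        exact hb
    · intro hb
      exact Or.inr ⟨v, rfl, h, hb⟩
  cases x with
  | p u v => exact hv.elim
  | y u v => exact hv.elim
  | r v => exact hv.elim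
  | rr v v' => exact hv.elim
  | q a w =>
    have : v.val + 1 = a := hv
    subst this
    exact aux _
  | z a w =>
    have : v.val + 1 = a := hv
    subst this
    exact aux _

theorem ment_unique (x : ERVar) (v v' : Fin n) (h : ment x v) (h' : ment x v') : v = v' := by
  cases x <;> simp only [ment] at h h'
  all_goals exact Fin.ext (by omega)

/-- unnormalised expectation with pigeon `a` left out -/
noncomputable def avg [NeZero k] (e : Fin k ↪ Fin n) (b : Fin n → Bool) (a : Fin k) :
    MvPolynomial (PV ERVar) ℝ →ₗ[ℝ] ℝ :=
  ∑ τ ∈ (Finset.univ : Finset (Equiv.Perm (Fin k))).filter (fun τ => τ a = 0),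
    (MvPolynomial.aeval (pt (asg e b τ))).toLinearMap

theorem avg_apply [NeZero k] (e : Fin k ↪ Fin n) (b : Fin n → Bool) (a : Fin k)
    (f : MvPolynomial (PV ERVar) ℝ) : avg e b a f =
    ∑ τ ∈ (Finset.univ : Finset (Equiv.Perm (Fin k))).filter (fun τ => τ a = 0),
      MvPolynomial.eval (pt (asg e b τ)) f := by
  simp [avg, MvPolynomial.aeval_def]

/-- the monomial avoids pigeon `e a` -/
def avoids (e : Fin k ↪ Fin n) (m : PV ERVar →₀ ℕ) (a : Fin k) : Prop :=
  ∀ x ∈ m.support, ¬ ment x.1 (e a)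

theorem avg_swap [NeZero k] (e : Fin k ↪ Fin n) (b : Fin n → Bool) (a a' : Fin k)
    (m : PV ERVar →₀ ℕ) (h : avoids e m a) (h' : avoids e m a') :
    avg e b a (monomial m 1) = avg e b a' (monomial m 1) := by
  rw [avg_apply, avg_apply]
  refine Finset.sum_equiv (Equiv.mulRight (Equiv.swap a a')) ?_ ?_
  · intro τ
    simp
  · intro τ _
    rw [eval_monomial, eval_monomial]
    congr 1
    refine Finset.prod_congr rfl fun x hx => ?_
    dsimp only
    congr 1
    apply pt_congr
    intro i hi
    have h1 : i ≠ a := by rintro rfl; exact h x hx hi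
    have h2 : i ≠ a' := by rintro rfl; exact h' x hx hi
    simp [Equiv.swap_apply_of_ne_of_ne h1 h2]

open Classical in
/-- pseudo-expectation on monomials -/
noncomputable def Lm [NeZero k] (e : Fin k ↪ Fin n) (b : Fin n → Bool) (m : PV ERVar →₀ ℕ) : ℝ :=
  if h : ∃ a, avoids e m a then avg e b h.choose (monomial m 1) else 0

theorem Lm_eq [NeZero k] (e : Fin k ↪ Fin n) (b : Fin n → Bool) (m : PV ERVar →₀ ℕ) (a : Fin k)
    (h : avoids e m a) : Lm e b m = avg e b a (monomial m 1) := by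
  have h' : ∃ a, avoids e m a := ⟨a, h⟩
  unfold Lm
  rw [dif_pos h']
  exact avg_swap e b _ _ m h'.choose_spec h

theorem Lm_zero [NeZero k] (e : Fin k ↪ Fin n) (b : Fin n → Bool) (m : PV ERVar →₀ ℕ)
    (h : ¬ ∃ a, avoids e m a) : Lm e b m = 0 := by
  unfold Lm
  rw [dif_neg h]

/-- the pseudo-expectation -/
noncomputable def LL [NeZero k] (e : Fin k ↪ Fin n) (b : Fin n → Bool) :
    MvPolynomial (PV ERVar) ℝ →ₗ[ℝ] ℝ :=
  (MvPolynomial.basisMonomials (PV ERVar) ℝ).constr ℝ (Lm e b)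

theorem LL_monomial [NeZero k] (e : Fin k ↪ Fin n) (b : Fin n → Bool) (m : PV ERVar →₀ ℕ) :
    LL e b (monomial m 1) = Lm e b m := by
  have := (MvPolynomial.basisMonomials (PV ERVar) ℝ).constr_basis ℝ (Lm e b) m
  rwa [MvPolynomial.coe_basisMonomials] at this

theorem LL_eq_avg [NeZero k] (e : Fin k ↪ Fin n) (b : Fin n → Bool) (a : Fin k)
    (f : MvPolynomial (PV ERVar) ℝ) (h : ∀ x ∈ f.vars, ¬ ment x.1 (e a)) :
    LL e b f = avg e b a f := by
  rw [f.as_sum, map_sum, map_sum]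
  refine Finset.sum_congr rfl fun m hm => ?_
  have : monomial m (coeff m f) = (coeff m f) • (monomial m 1 : MvPolynomial (PV ERVar) ℝ) := by
    rw [smul_monomial]; simp
  rw [this, map_smul, map_smul, LL_monomial, Lm_eq e b m a]
  intro x hx
  exact h x ((MvPolynomial.mem_vars_iff_mem_support x).2 ⟨m, hm, hx⟩)

theorem LL_kill0 [NeZero k] (e : Fin k ↪ Fin n) (b : Fin n → Bool) (x : PV ERVar)
    (hx : ∀ τ, pt (asg e b τ) x = 0) (g : MvPolynomial (PV ERVar) ℝ) : LL e b (X x * g) = 0 := by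
  have : (LL e b) ∘ₗ (LinearMap.mulLeft ℝ (X x)) = 0 := by
    refine (MvPolynomial.basisMonomials (PV ERVar) ℝ).ext fun m => ?_
    rw [MvPolynomial.coe_basisMonomials]
    simp only [LinearMap.comp_apply, LinearMap.mulLeft_apply, LinearMap.zero_apply]
    rw [X, monomial_mul, one_mul, LL_monomial]
    by_cases h : ∃ a, avoids e (Finsupp.single x 1 + m) a
    · obtain ⟨a, ha⟩ := h
      rw [Lm_eq e b _ a ha, avg_apply]
      refine Finset.sum_eq_zero fun τ _ => ?_
      rw [← one_mul (1 : ℝ), ← monomial_mul, map_mul]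
      change eval _ (X x) * _ = 0
      rw [eval_X, hx τ, zero_mul]
    · exact Lm_zero _ _ _ h
  have := congrArg (fun l => l g) this
  simpa using this

theorem LL_kill1 [NeZero k] (e : Fin k ↪ Fin n) (b : Fin n → Bool) (x : PV ERVar)
    (hm : ∀ i, ¬ ment x.1 (e i))
    (hx : ∀ τ, pt (asg e b τ) x = 1) (g : MvPolynomial (PV ERVar) ℝ) :
    LL e b ((1 - X x) * g) = 0 := by
  have : (LL e b) ∘ₗ (LinearMap.mulLeft ℝ (X x)) = LL e b := by
    refine (MvPolynomial.basisMonomials (PV ERVar) ℝ).ext fun m => ?_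
    rw [MvPolynomial.coe_basisMonomials]
    simp only [LinearMap.comp_apply, LinearMap.mulLeft_apply]
    rw [X, monomial_mul, one_mul, LL_monomial, LL_monomial]
    have hav : ∀ a, avoids e (Finsupp.single x 1 + m) a ↔ avoids e m a := by
      intro a
      unfold avoids
      constructor
      · intro h y hy
        apply h y
        simp at hy ⊢
        intro _; exact hy
      · intro h y hy
        by_cases hyx : y = x
        · subst hyx; exact hm a
        · apply h y
          simp [Finsupp.single_apply, Ne.symm hyx] at hy ⊢
          exact hy
    by_cases h : ∃ a, avoids e m a
    · obtain ⟨a, ha⟩ := h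
      rw [Lm_eq e b _ a ha, Lm_eq e b _ a ((hav a).2 ha), avg_apply, avg_apply]
      refine Finset.sum_congr rfl fun τ _ => ?_
      rw [← one_mul (1 : ℝ), ← monomial_mul, map_mul]
      change eval _ (X x) * _ = _
      rw [eval_X, hx τ, one_mul, one_mul]
    · rw [Lm_zero _ _ _ h, Lm_zero]
      simpa only [hav] using h
  have := congrArg (fun l => l g) this
  simp only [LinearMap.comp_apply, LinearMap.mulLeft_apply] at this
  rw [sub_mul, one_mul, map_sub, this, sub_self]

theorem clause_eval (A : ERVar → Prop) (C : Clause ERVar)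
    (h : ∃ l ∈ C, (A l.1 ↔ l.2 = true)) : 0 ≤ eval (pt A) (encodeIneqSAR C) := by
  obtain ⟨l, hl, h⟩ := h
  unfold encodeIneqSAR
  simp only [map_sub, map_sum, eval_X, map_one, sub_nonneg]
  have h1 : pt A (l.1, !l.2) = 1 := by
    unfold pt
    rw [if_pos]
    rw [h]; simp
  rw [← h1]
  exact Finset.single_le_sum (f := fun l : ERVar × Bool => pt A (l.1, !l.2))
    (fun i _ => pt_nonneg _ _) hl

theorem clause_vars (C : Clause ERVar) (x : PV ERVar) (hx : x ∈ (encodeIneqSAR C).vars) :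
    ∃ l ∈ C, l.1 = x.1 := by
  classical
  unfold encodeIneqSAR at hx
  have h1 := MvPolynomial.vars_sub_subset _ hx
  rw [vars_one, Finset.union_empty] at h1
  have h2 := MvPolynomial.vars_sum_subset _ _ h1
  obtain ⟨l, hl, h3⟩ := Finset.mem_biUnion.1 h2
  rw [vars_X] at h3
  simp at h3
  exact ⟨l, hl, by rw [h3]⟩

theorem encode_ne_zero (C : Clause ERVar) : encodeIneqSAR C ≠ 0 := by
  intro h
  have := congrArg (eval (fun _ => (0:ℝ))) h
  simp [encodeIneqSAR] at this

theorem clause_sat [NeZero k] (hn : 4 ≤ n) (hk : 4 ≤ k) (C : Clause ERVar) (hC : C ∈ ERPHP n k) :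
    ∃ N : Finset (Fin n), N.card ≤ 2 ∧ (∀ l ∈ C, ∀ v, ment l.1 v → v ∈ N) ∧
      ∀ (e : Fin k ↪ Fin n) b a τ, e a ∉ N → τ a = 0 → ∃ l ∈ C, (asg e b τ l.1 ↔ l.2 = true) := by
  have hτ : ∀ (τ : Equiv.Perm (Fin k)) (a i : Fin k), τ a = 0 → i ≠ a → 1 ≤ (τ i).val := by
    intro τ a i h hi
    by_contra hc
    apply hi
    apply τ.injective
    rw [h]
    apply Fin.ext
    have h0 : (0 : Fin k).val = 0 := by simp
    omega
  have hlt : ∀ v, 1 ≤ v → v ≤ n → v - 1 < n := fun v h1 h2 => by omega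
  rcases hC with ⟨u, h1, h2, rfl⟩ | ⟨u, v, h1, h2, h3, h4, rfl⟩ | ⟨u, h1, h2, rfl⟩ |
    ⟨v, h1, h2, rfl⟩ | ⟨v, w, h1, h2, h3, h4, rfl⟩ | ⟨v, h1, h2, rfl⟩ |
    ⟨u, u', v, h1, h2, h3, h4, hne, h5, h6, rfl⟩ | ⟨u, v, h1, h2, h3, h4, rfl⟩ |
    ⟨v, v', h1, h2, h3, h4, hne, rfl⟩ | ⟨v, v', w, h1, h2, h3, h4, hne, h5, h6, rfl⟩
  · refine ⟨∅, by simp, by simp [ment], ?_⟩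
    intro e b a τ _ _
    have hu : u - 1 < k := by omega
    have hi : (⟨u-1, hu⟩ : Fin k).val + 1 = u := by simp; omega
    generalize (⟨u-1, hu⟩ : Fin k) = i at hi
    rcases lt_trichotomy (e i).val 1 with h | h | h
    · exact ⟨(ERVar.p u 1, true), by simp, by simp [asg]; exact ⟨i, hi, by simpa using h⟩⟩
    · exact ⟨(ERVar.p u 2, true), by simp, by simp [asg]; exact ⟨i, hi, by simpa using h⟩⟩
    · exact ⟨(ERVar.y u 2, true), by simp, by simp [asg]; exact ⟨i, hi, by omega⟩⟩
  · refine ⟨∅, by simp, by simp [ment], ?_⟩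
    intro e b a τ _ _
    have hu : u - 1 < k := by omega
    have hi : (⟨u-1, hu⟩ : Fin k).val + 1 = u := by simp; omega
    generalize (⟨u-1, hu⟩ : Fin k) = i at hi
    rcases lt_trichotomy (e i).val v with h | h | h
    · refine ⟨(ERVar.y u v, false), by simp, ?_⟩
      simp [asg]
      intro j hj
      obtain rfl : i = j := Fin.ext (by omega)
      omega
    · exact ⟨(ERVar.p u (v+1), true), by simp, by simp [asg]; exact ⟨i, hi, by simpa using h⟩⟩
    · exact ⟨(ERVar.y u (v+1), true), by simp, by simp [asg]; exact ⟨i, hi, by omega⟩⟩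
  · refine ⟨∅, by simp, by simp [ment], ?_⟩
    intro e b a τ _ _
    have hu : u - 1 < k := by omega
    have hi : (⟨u-1, hu⟩ : Fin k).val + 1 = u := by simp; omega
    generalize (⟨u-1, hu⟩ : Fin k) = i at hi
    have := (e i).isLt
    rcases lt_trichotomy (e i).val (n-2) with h | h | h
    · refine ⟨(ERVar.y u (n-2), false), by simp, ?_⟩
      simp [asg]
      intro j hj
      obtain rfl : i = j := Fin.ext (by omega)
      omega
    · exact ⟨(ERVar.p u (n-1), true), by simp, by simp [asg]; exact ⟨i, hi, by omega⟩⟩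
    · exact ⟨(ERVar.p u n, true), by simp, by simp [asg]; exact ⟨i, hi, by omega⟩⟩
  · refine ⟨{⟨v-1, hlt v h1 h2⟩}, by simp, ?_, ?_⟩
    · simp [ment, Fin.ext_iff]; omega
    intro e b a τ ha hτa
    simp [Fin.ext_iff] at ha
    by_cases hr : ∃ i, (e i).val + 1 = v
    · obtain ⟨i, hi⟩ := hr
      have h := hτ τ a i hτa (by rintro rfl; omega)
      by_cases h' : (τ i).val = 1
      · exact ⟨(ERVar.q v 1, true), by simp, by simp [asg]; exact Or.inl ⟨i, hi, h'⟩⟩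
      · exact ⟨(ERVar.z v 1, true), by simp, by simp [asg]; exact Or.inl ⟨i, hi, by omega⟩⟩
    · exact ⟨(ERVar.r v, false), by simp, by simpa [asg] using hr⟩
  · refine ⟨{⟨v-1, hlt v h1 h2⟩}, by simp, ?_, ?_⟩
    · simp [ment, Fin.ext_iff]; omega
    intro e b a τ ha hτa
    by_cases hr : ∃ i, (e i).val + 1 = v
    · obtain ⟨i, hi⟩ := hr
      rcases lt_trichotomy (τ i).val (w+1) with h | h | h
      · refine ⟨(ERVar.z v w, false), by simp, ?_⟩
        have hz : ¬ asg e b τ (ERVar.z v w) := by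
          rintro (⟨j, hj, hj'⟩ | ⟨x, hx, hx', _⟩)
          · obtain rfl : i = j := e.injective (Fin.ext (by omega))
            omega
          · exact hx' i (Fin.ext (by omega))
        simp [hz]
      · exact ⟨(ERVar.q v (w+1), true), by simp, by simp [asg]; exact Or.inl ⟨i, hi, h⟩⟩
      · exact ⟨(ERVar.z v (w+1), true), by simp, by simp [asg]; exact Or.inl ⟨i, hi, h⟩⟩
    · have hm : ∀ i, e i ≠ ⟨v-1, hlt v h1 h2⟩ := by
        intro i h
        exact hr ⟨i, by rw [h]; simp; omega⟩
      have m1 : ment (ERVar.z v w) (⟨v-1, hlt v h1 h2⟩ : Fin n) := by simp [ment]; omega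
      have m2 : ment (ERVar.q v (w+1)) (⟨v-1, hlt v h1 h2⟩ : Fin n) := by simp [ment]; omega
      have a1 := asg_free e b τ _ _ m1 hm
      have a2 := asg_free e b τ _ _ m2 hm
      by_cases hb : b ⟨v-1, hlt v h1 h2⟩ = true
      · exact ⟨(ERVar.q v (w+1), true), by simp, by simp [a2, hb]⟩
      · exact ⟨(ERVar.z v w, false), by simp, by simp [a1, hb]⟩
  · refine ⟨{⟨v-1, hlt v h1 h2⟩}, by simp, ?_, ?_⟩
    · simp [ment, Fin.ext_iff]; omega
    intro e b a τ ha hτa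
    by_cases hr : ∃ i, (e i).val + 1 = v
    · obtain ⟨i, hi⟩ := hr
      have := (τ i).isLt
      rcases lt_trichotomy (τ i).val (k-2) with h | h | h
      · refine ⟨(ERVar.z v (k-3), false), by simp, ?_⟩
        have hz : ¬ asg e b τ (ERVar.z v (k-3)) := by
          rintro (⟨j, hj, hj'⟩ | ⟨x, hx, hx', _⟩)
          · obtain rfl : i = j := e.injective (Fin.ext (by omega))
            omega
          · exact hx' i (Fin.ext (by omega))
        simp [hz]
      · exact ⟨(ERVar.q v (k-2), true), by simp, by simp [asg]; exact Or.inl ⟨i, hi, h⟩⟩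
      · exact ⟨(ERVar.q v (k-1), true), by simp, by
          simp [asg]; exact Or.inl ⟨i, hi, by omega⟩⟩
    · have hm : ∀ i, e i ≠ ⟨v-1, hlt v h1 h2⟩ := by
        intro i h
        exact hr ⟨i, by rw [h]; simp; omega⟩
      have m1 : ment (ERVar.z v (k-3)) (⟨v-1, hlt v h1 h2⟩ : Fin n) := by simp [ment]; omega
      have m2 : ment (ERVar.q v (k-2)) (⟨v-1, hlt v h1 h2⟩ : Fin n) := by simp [ment]; omega
      have a1 := asg_free e b τ _ _ m1 hm
      have a2 := asg_free e b τ _ _ m2 hm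
      by_cases hb : b ⟨v-1, hlt v h1 h2⟩ = true
      · exact ⟨(ERVar.q v (k-2), true), by simp, by simp [a2, hb]⟩
      · exact ⟨(ERVar.z v (k-3), false), by simp, by simp [a1, hb]⟩
  · refine ⟨∅, by simp, by simp [ment], ?_⟩
    intro e b a τ _ _
    by_cases hp : asg e b τ (ERVar.p u v)
    · refine ⟨(ERVar.p u' v, false), by simp, ?_⟩
      have : ¬ asg e b τ (ERVar.p u' v) := by
        rintro ⟨j, hj, hj'⟩
        obtain ⟨i, hi, hi'⟩ := hp
        obtain rfl : i = j := e.injective (Fin.ext (by omega))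
        omega
      simp [this]
    · exact ⟨(ERVar.p u v, false), by simp, by simp [hp]⟩
  · refine ⟨∅, by simp, by simp [ment], ?_⟩
    intro e b a τ _ _
    by_cases hp : asg e b τ (ERVar.p u v)
    · refine ⟨(ERVar.r v, true), by simp, ?_⟩
      obtain ⟨i, hi, hi'⟩ := hp
      simp [asg]
      exact ⟨i, hi'⟩
    · exact ⟨(ERVar.p u v, false), by simp, by simp [hp]⟩
  · refine ⟨∅, by simp, by simp [ment], ?_⟩
    intro e b a τ _ _
    by_cases hp : asg e b τ (ERVar.r v)
    · by_cases hp' : asg e b τ (ERVar.r v')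
      · have : asg e b τ (ERVar.rr v v') := ⟨hp, hp'⟩
        exact ⟨(ERVar.rr v v', true), by simp, by simp [this]⟩
      · exact ⟨(ERVar.r v', false), by simp, by simp [hp']⟩
    · exact ⟨(ERVar.r v, false), by simp, by simp [hp]⟩
  · refine ⟨{⟨v-1, hlt v h1 h2⟩, ⟨v'-1, hlt v' h3 h4⟩}, Finset.card_le_two, ?_, ?_⟩
    · intro l hl x hx
      simp at hl
      rcases hl with rfl | rfl | rfl
      · exact hx.elim
      · have : x.val + 1 = v := hx
        simp [Fin.ext_iff]; omega
      · have : x.val + 1 = v' := hx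
        simp [Fin.ext_iff]; omega
    intro e b a τ ha hτa
    by_cases hp : asg e b τ (ERVar.rr v v')
    · obtain ⟨⟨i, hi⟩, ⟨i', hi'⟩⟩ := hp
      have hq : ∀ j x, (e j).val + 1 = x → asg e b τ (ERVar.q x w) → (τ j).val = w := by
        intro j x hj hx
        rcases hx with ⟨j', hj', hw⟩ | ⟨y, hy, hy', _⟩
        · obtain rfl : j = j' := e.injective (Fin.ext (by omega))
          exact hw
        · exact absurd (Fin.ext (by omega)) (hy' j)
      by_cases hq1 : asg e b τ (ERVar.q v w)
      · by_cases hq2 : asg e b τ (ERVar.q v' w)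
        · have e1 := hq i v hi hq1
          have e2 := hq i' v' hi' hq2
          have : i = i' := τ.injective (Fin.ext (by omega))
          subst this
          omega
        · exact ⟨(ERVar.q v' w, false), by simp, by simp [hq2]⟩
      · exact ⟨(ERVar.q v w, false), by simp, by simp [hq1]⟩
    · exact ⟨(ERVar.rr v v', false), by simp, by simp [hp]⟩

theorem axiom_ok [NeZero k] (hn : 4 ≤ n) (hk : 4 ≤ k) (p : MvPolynomial (PV ERVar) ℝ)
    (hp : p ∈ SARAxioms ERVar ((fun C => encodeIneqSAR C) '' ERPHP n k)) :
    p ≠ 0 ∧ ∃ N : Finset (Fin n), N.card ≤ 2 ∧ (∀ x ∈ p.vars, ∀ v, ment x.1 v → v ∈ N) ∧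
      ∀ (e : Fin k ↪ Fin n) b a τ, e a ∉ N → τ a = 0 → 0 ≤ eval (pt (asg e b τ)) p := by
  classical
  have single : ∀ (v : ERVar), (∀ x ∈ p.vars, x.1 = v) →
      ∃ N : Finset (Fin n), N.card ≤ 2 ∧ (∀ x ∈ p.vars, ∀ v, ment x.1 v → v ∈ N) := by
    intro v hv
    refine ⟨Finset.univ.filter (fun x => ment v x), ?_, ?_⟩
    · refine (Finset.card_le_one.2 ?_).trans (by omega)
      intro a ha b hb
      simp at ha hb
      exact ment_unique v a b ha hb
    · intro x hx w hw
      rw [hv x hx] at hw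
      simpa using hw
  rcases hp with ((⟨C, hC, rfl⟩ | ⟨x, hx⟩) | h1) | ⟨v, hv⟩
  · refine ⟨encode_ne_zero C, ?_⟩
    obtain ⟨N, h1, h2, h3⟩ := clause_sat hn hk C hC
    refine ⟨N, h1, ?_, ?_⟩
    · intro x hx v hv
      obtain ⟨l, hl, hlx⟩ := clause_vars C x hx
      exact h2 l hl v (by rw [hlx]; exact hv)
    · intro e b a τ ha hτ
      exact clause_eval _ _ (h3 e b a τ ha hτ)
  · refine ⟨?_, ?_⟩
    · intro h0
      rw [h0] at hx
      rcases hx with h | h <;>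
      · have := congrArg (eval (fun _ => (2:ℝ))) h
        norm_num at this
    · have hvars : ∀ y ∈ p.vars, y.1 = x.1 := by
        have h2 : ∀ y ∈ (X x ^ 2 : MvPolynomial (PV ERVar) ℝ).vars ∪ (X x : MvPolynomial (PV ERVar) ℝ).vars, y.1 = x.1 := by
          intro y hy
          rcases Finset.mem_union.1 hy with hy | hy
          · have := vars_pow _ _ hy
            rw [vars_X] at this
            simp at this
            rw [this]
          · rw [vars_X] at hy
            simp at hy
            rw [hy]
        intro y hy
        rcases hx with h | h
        · rw [h] at hy
          exact h2 y (vars_sub_subset _ hy)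
        · rw [h] at hy
          have := vars_sub_subset _ hy
          rw [Finset.union_comm] at this
          exact h2 y this
      obtain ⟨N, h1, h2⟩ := single x.1 hvars
      refine ⟨N, h1, h2, ?_⟩
      intro e b a τ _ _
      apply le_of_eq
      rcases hx with h | h <;> rw [h] <;> rcases pt_01 (asg e b τ) x with h' | h' <;> simp [h']
  · have h1 : p = 1 := h1
    subst h1
    exact ⟨one_ne_zero, ∅, by simp, by simp, by simp⟩
  · refine ⟨?_, ?_⟩
    · intro h0
      rw [h0] at hv
      rcases hv with h | h <;>
      · have := congrArg (eval (fun _ => (0:ℝ))) h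
        norm_num at this
    · have hvars : ∀ y ∈ p.vars, y.1 = v := by
        intro y hy
        have hX : ∀ c, y ∈ (X (v, c) : MvPolynomial (PV ERVar) ℝ).vars → y.1 = v := by
          intro c h
          rw [vars_X] at h
          simp at h
          rw [h]
        rcases hv with h | h
        · rw [h] at hy
          rcases Finset.mem_union.1 (vars_sub_subset _ hy) with hy | hy
          · rcases Finset.mem_union.1 (vars_sub_subset _ hy) with hy | hy
            · simp at hy
            · exact hX _ hy
          · exact hX _ hy
        · rw [h] at hy
          rcases Finset.mem_union.1 (vars_add_subset _ _ hy) with hy | hy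
          · rcases Finset.mem_union.1 (vars_add_subset _ _ hy) with hy | hy
            · simp [vars_neg] at hy
            · exact hX _ hy
          · exact hX _ hy
      obtain ⟨N, h1, h2⟩ := single v hvars
      refine ⟨N, h1, h2, ?_⟩
      intro e b a τ _ _
      have := pt_twin (asg e b τ) v
      rcases hv with h | h <;> rw [h] <;> simp <;> linarith

end Lower

section Lower2

variable {n k : ℕ}

theorem line_ok [NeZero k] (hn : 4 ≤ n) (hk : 4 ≤ k) (I J : Finset (PV ERVar))
    (p : MvPolynomial (PV ERVar) ℝ)
    (hp : p ∈ SARAxioms ERVar ((fun C => encodeIneqSAR C) '' ERPHP n k)) :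
    ∃ (U W : Finset (Fin n)) (c : Fin n → Bool), U.card ≤ W.card + 2 ∧
      ∀ (e : Fin k ↪ Fin n) (b : Fin n → Bool), 0 ≤ LL e b (expandTerm I J p) ∨
        ((∀ a, e a ∈ U) ∧ ∀ v ∈ W, (∀ i, e i ≠ v) → b v = c v) := by
  classical
  obtain ⟨-, N, hN, hNv, hNe⟩ := axiom_ok hn hk p hp
  set W : Finset (Fin n) := Finset.univ.filter (fun v => ∃ x ∈ I ∪ J, ment x.1 v) with hW
  have hch : ∀ v, ∃ cv : Bool, v ∈ W → ∃ x, ment x.1 v ∧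
      ((x ∈ I ∧ cv = !x.2) ∨ (x ∈ J ∧ cv = x.2)) := by
    intro v
    by_cases hv : v ∈ W
    · obtain ⟨x, hx, hm⟩ := (Finset.mem_filter.1 hv).2
      rcases Finset.mem_union.1 hx with h | h
      · exact ⟨!x.2, fun _ => ⟨x, hm, Or.inl ⟨h, rfl⟩⟩⟩
      · exact ⟨x.2, fun _ => ⟨x, hm, Or.inr ⟨h, rfl⟩⟩⟩
    · exact ⟨true, fun h => absurd h hv⟩
  choose c hc using hch
  refine ⟨W ∪ N, W, c, (Finset.card_union_le _ _).trans (by omega), ?_⟩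
  intro e b
  by_cases h1 : ∀ a, e a ∈ W ∪ N
  swap
  · left
    push Not at h1
    obtain ⟨a, ha⟩ := h1
    rw [Finset.mem_union, not_or] at ha
    have hIJ : ∀ x ∈ I ∪ J, ¬ ment x.1 (e a) := by
      intro x hx hm
      exact ha.1 (by simp only [hW, Finset.mem_filter, Finset.mem_univ, true_and]; exact ⟨x, hx, hm⟩)
    rw [LL_eq_avg e b a, avg_apply]
    · refine Finset.sum_nonneg fun τ hτ => ?_
      have h0 := hNe e b a τ ha.2 (Finset.mem_filter.1 hτ).2
      unfold expandTerm
      simp only [map_mul, map_prod, map_sub, map_one, eval_X]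
      refine mul_nonneg (mul_nonneg (Finset.prod_nonneg fun i _ => pt_nonneg _ _)
        (Finset.prod_nonneg fun i _ => ?_)) h0
      rcases pt_01 (asg e b τ) i with h | h <;> simp [h]
    · intro x hx
      unfold expandTerm at hx
      rcases Finset.mem_union.1 (vars_mul _ _ hx) with hx | hx
      · apply hIJ
        rcases Finset.mem_union.1 (vars_mul _ _ hx) with hx | hx
        · have := vars_prod _ hx
          obtain ⟨i, hi, hxi⟩ := Finset.mem_biUnion.1 this
          rw [vars_X] at hxi
          simp at hxi
          subst hxi
          exact Finset.mem_union_left _ hi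
        · have := vars_prod _ hx
          obtain ⟨i, hi, hxi⟩ := Finset.mem_biUnion.1 this
          have := vars_sub_subset _ hxi
          rw [vars_X, vars_one] at this
          simp at this
          subst this
          exact Finset.mem_union_right _ hi
      · intro hm
        exact ha.2 (hNv x hx _ hm)
  by_cases h2 : ∀ v ∈ W, (∀ i, e i ≠ v) → b v = c v
  · exact Or.inr ⟨h1, h2⟩
  left
  push Not at h2
  obtain ⟨v, hv, hev, hb⟩ := h2
  obtain ⟨x, hm, hx⟩ := hc v hv
  have hasg := fun τ => asg_free e b τ x.1 v hm hev
  apply le_of_eq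
  symm
  unfold expandTerm
  rcases hx with ⟨hx, hcx⟩ | ⟨hx, hcx⟩
  · rw [← Finset.mul_prod_erase I _ hx, mul_assoc, mul_assoc]
    apply LL_kill0
    intro τ
    unfold pt
    rw [if_neg]
    rw [hasg τ]
    rw [hcx] at hb
    revert hb
    cases b v <;> cases x.2 <;> simp
  · rw [← Finset.mul_prod_erase J _ hx, mul_comm (∏ i ∈ I, X i), mul_assoc, mul_assoc]
    apply LL_kill1
    · intro i hi
      exact hev i (ment_unique _ _ _ hi hm)
    · intro τ
      unfold pt
      rw [if_pos]
      rw [hasg τ]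
      rw [hcx] at hb
      revert hb
      cases b v <;> cases x.2 <;> simp

theorem exists_bad [NeZero k] (d : SAStyleDeriv (PV ERVar)
      (SARAxioms ERVar ((fun C => encodeIneqSAR C) '' ERPHP n k)) (-1))
    (e : Fin k ↪ Fin n) (b : Fin n → Bool)  :
    ∃ t, ¬ 0 ≤ LL e b (expandTerm (d.I t) (d.J t) (d.p t)) := by
  by_contra! h
  have h1 : 0 ≤ LL e b (-1) := by
    rw [← d.sums, map_sum]
    refine Finset.sum_nonneg fun t _ => ?_
    rw [map_smul]
    exact mul_nonneg (d.alpha_nonneg t) (h t)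
  rw [LL_eq_avg e b 0, avg_apply] at h1
  · simp at h1
    exact h1 (x := 1) (by simp)
  · simp [vars_neg]

theorem len_le_size (hn : 4 ≤ n) (hk : 4 ≤ k) (d : SAStyleDeriv (PV ERVar)
      (SARAxioms ERVar ((fun C => encodeIneqSAR C) '' ERPHP n k)) (-1)) : d.len ≤ d.size := by
  haveI : NeZero k := ⟨by omega⟩
  unfold SAStyleDeriv.size
  have : ∑ t : Fin d.len, 1 ≤ ∑ t, (expandTerm (d.I t) (d.J t) (d.p t)).support.card := by
    refine Finset.sum_le_sum fun t _ => ?_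
    rw [Nat.one_le_iff_ne_zero, Finset.card_ne_zero, MvPolynomial.support_nonempty]
    unfold expandTerm
    refine mul_ne_zero (mul_ne_zero ?_ ?_) (axiom_ok hn hk _ (d.p_mem t)).1
    · exact Finset.prod_ne_zero_iff.2 fun i _ => X_ne_zero i
    · refine Finset.prod_ne_zero_iff.2 fun i _ h => ?_
      have := congrArg (eval (fun _ => (0:ℝ))) h
      simp at this
  simpa using this

theorem card_fixed (W : Finset (Fin n)) (c : Fin n → Bool) :
    ((Finset.univ : Finset (Fin n → Bool)).filter (fun b => ∀ v ∈ W, b v = c v)).card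
      * 2 ^ W.card = 2 ^ n := by
  classical
  have : (Finset.univ : Finset (Fin n → Bool)).filter (fun b => ∀ v ∈ W, b v = c v) =
      Fintype.piFinset (fun v => if v ∈ W then {c v} else Finset.univ) := by
    ext b
    simp only [Finset.mem_filter, Finset.mem_univ, true_and, Fintype.mem_piFinset]
    refine forall_congr' fun v => ?_
    split_ifs with h <;> simp [h]
  rw [this, Fintype.card_piFinset]
  have h2 : 2 ^ W.card = ∏ v : Fin n, if v ∈ W then 2 else 1 := by
    rw [Finset.prod_ite_mem]; simp
  have h3 : 2 ^ n = ∏ v : Fin n, 2 := by simp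
  rw [h2, h3, ← Finset.prod_mul_distrib]
  refine Finset.prod_congr rfl fun v _ => ?_
  split_ifs <;> simp

theorem card_emb (U : Finset (Fin n)) :
    ((Finset.univ : Finset (Fin k ↪ Fin n)).filter (fun e => ∀ a, e a ∈ U)).card
      ≤ U.card.descFactorial k := by
  classical
  have h : Fintype.card (Fin k ↪ U) = U.card.descFactorial k := by
    rw [Fintype.card_embedding_eq]; simp
  rw [← h, ← Finset.card_univ]
  refine (Finset.card_le_card (t := Finset.univ.image
    (fun f : Fin k ↪ U => f.trans (Function.Embedding.subtype _))) ?_).trans Finset.card_image_le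
  intro e he
  have he := (Finset.mem_filter.1 he).2
  rw [Finset.mem_image]
  exact ⟨⟨fun a => ⟨e a, he a⟩, fun a a' h => e.injective (by simpa using h)⟩, Finset.mem_univ _,
    by ext a; rfl⟩

theorem desc_ratio (m n k : ℕ) (h : m ≤ n) :
    m.descFactorial k * n ^ k ≤ n.descFactorial k * m ^ k := by
  induction k with
  | zero => simp
  | succ k ih =>
    rw [Nat.descFactorial_succ, Nat.descFactorial_succ, pow_succ, pow_succ]
    have h2 : (m - k) * n ≤ (n - k) * m := by
      rw [Nat.sub_mul, Nat.sub_mul, mul_comm m n]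
      have : k * m ≤ k * n := Nat.mul_le_mul_left _ h
      omega
    calc (m - k) * m.descFactorial k * (n ^ k * n)
        = ((m - k) * n) * (m.descFactorial k * n ^ k) := by ring
      _ ≤ ((n - k) * m) * (n.descFactorial k * m ^ k) := Nat.mul_le_mul h2 ih
      _ = _ := by ring

/-- the bad restrictions of a line -/
noncomputable def badSet (k : ℕ) (U W : Finset (Fin n)) (c : Fin n → Bool) :
    Finset ((Fin k ↪ Fin n) × (Fin n → Bool)) :=
  open Classical in Finset.univ.filter
    (fun z => (∀ a, z.1 a ∈ U) ∧ ∀ v ∈ W, (∀ i, z.1 i ≠ v) → z.2 v = c v)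

theorem bad1 (U W : Finset (Fin n)) (c : Fin n → Bool) :
    (badSet k U W c).card * n ^ k ≤ n.descFactorial k * U.card ^ k * 2 ^ n := by
  classical
  have h1 : (badSet k U W c).card ≤ U.card.descFactorial k * 2 ^ n := by
    have hs : badSet k U W c ⊆
        ((Finset.univ : Finset (Fin k ↪ Fin n)).filter (fun e => ∀ a, e a ∈ U)) ×ˢ
        (Finset.univ : Finset (Fin n → Bool)) := by
      intro z hz
      have := (Finset.mem_filter.1 hz).2
      simp
      exact this.1
    refine (Finset.card_le_card hs).trans ?_
    rw [Finset.card_product]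
    refine Nat.mul_le_mul (card_emb U) ?_
    simp
  have h2 : U.card ≤ n := by simpa using Finset.card_le_univ U
  have h3 := desc_ratio U.card n k h2
  calc _ ≤ U.card.descFactorial k * 2 ^ n * n ^ k := Nat.mul_le_mul_right _ h1
    _ = (U.card.descFactorial k * n ^ k) * 2 ^ n := by ring
    _ ≤ _ := Nat.mul_le_mul_right _ h3

theorem bad2 (U W : Finset (Fin n)) (c : Fin n → Bool) (h : U.card ≤ W.card + 2) :
    (badSet k U W c).card * 2 ^ U.card ≤ n.descFactorial k * 2 ^ n * 2 ^ (k + 2) := by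
  classical
  have h1 : (badSet k U W c).card ≤ ∑ e : Fin k ↪ Fin n,
      ((Finset.univ : Finset (Fin n → Bool)).filter
        (fun b => ∀ v ∈ W \ Finset.univ.image e, b v = c v)).card := by
    rw [← Finset.card_sigma]
    refine Finset.card_le_card_of_injOn (fun z => ⟨z.1, z.2⟩) ?_ ?_
    · intro z hz
      have := (Finset.mem_filter.1 hz).2
      simp
      intro v hv hv'
      exact this.2 v hv hv'
    · rintro ⟨a, b⟩ _ ⟨a', b'⟩ _ h
      simpa using h
  have hc : Fintype.card (Fin k ↪ Fin n) = n.descFactorial k := by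
    rw [Fintype.card_embedding_eq]; simp
  calc _ ≤ (∑ e : Fin k ↪ Fin n, ((Finset.univ : Finset (Fin n → Bool)).filter
        (fun b => ∀ v ∈ W \ Finset.univ.image e, b v = c v)).card) * 2 ^ U.card :=
        Nat.mul_le_mul_right _ h1
    _ ≤ ∑ e : Fin k ↪ Fin n, 2 ^ n * 2 ^ (k+2) := by
        rw [Finset.sum_mul]
        refine Finset.sum_le_sum fun e _ => ?_
        rw [← card_fixed (W \ Finset.univ.image e) c, mul_assoc, ← pow_add]
        refine Nat.mul_le_mul_left _ (Nat.pow_le_pow_right (by omega) ?_)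
        have h3 := Finset.le_card_sdiff (Finset.univ.image e) W
        have h4 : (Finset.univ.image e).card ≤ k := Finset.card_image_le.trans (by simp)
        omega
    _ = _ := by
        rw [Finset.sum_const, Finset.card_univ, hc]
        simp only [smul_eq_mul]
        ring

theorem bad_real (hn : 4 ≤ n) (hk : 4 ≤ k) (U W : Finset (Fin n)) (c : Fin n → Bool)
    (h : U.card ≤ W.card + 2) :
    ((badSet k U W c).card : ℝ) * (n : ℝ) ^ k ≤
      4 * (2 * (k : ℝ) * Real.logb 2 (n : ℝ)) ^ k * ((n.descFactorial k : ℝ) * 2 ^ n) := by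
  have hn' : (4 : ℝ) ≤ n := by exact_mod_cast hn
  have hk' : (4 : ℝ) ≤ k := by exact_mod_cast hk
  have hlog : 1 ≤ Real.logb 2 (n : ℝ) := by
    rw [Real.le_logb_iff_rpow_le (by norm_num) (by linarith)]
    norm_num; linarith
  set κ := 2 * (k : ℝ) * Real.logb 2 (n : ℝ) with hκ
  have hκ2 : 2 ≤ κ := by nlinarith
  have hD : (0 : ℝ) ≤ (n.descFactorial k : ℝ) * 2 ^ n := by positivity
  by_cases hU : (U.card : ℝ) ≤ κ
  · have h1 : ((badSet k U W c).card : ℝ) * (n : ℝ) ^ k ≤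
        n.descFactorial k * (U.card : ℝ) ^ k * 2 ^ n := by
      exact_mod_cast bad1 (k := k) U W c
    have h2 : (U.card : ℝ) ^ k ≤ κ ^ k := pow_le_pow_left₀ (by positivity) hU k
    have h3 : 0 ≤ κ ^ k := by positivity
    calc _ ≤ (U.card : ℝ) ^ k * ((n.descFactorial k : ℝ) * 2 ^ n) := by linarith
      _ ≤ 4 * κ ^ k * ((n.descFactorial k : ℝ) * 2 ^ n) := by
        apply mul_le_mul_of_nonneg_right _ hD
        linarith
  · push Not at hU
    have h1 : ((badSet k U W c).card : ℝ) * 2 ^ U.card ≤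
        n.descFactorial k * 2 ^ n * 2 ^ (k + 2) := by
      exact_mod_cast bad2 (k := k) U W c h
    have h2 : (n : ℝ) ^ k * (n : ℝ) ^ k ≤ 2 ^ U.card := by
      have : (2 : ℝ) ^ κ ≤ 2 ^ (U.card : ℝ) :=
        Real.rpow_le_rpow_of_exponent_le (by norm_num) hU.le
      rw [Real.rpow_natCast] at this
      refine le_trans (le_of_eq ?_) this
      rw [hκ, mul_comm (2 * (k : ℝ)), Real.rpow_mul (by norm_num), Real.rpow_logb (by norm_num) (by norm_num)
        (by linarith), ← pow_add, ← Real.rpow_natCast]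
      congr 1
      push_cast
      ring
    have hB : (0 : ℝ) ≤ (badSet k U W c).card := by positivity
    have h3 : (1 : ℝ) ≤ (n : ℝ) ^ k := one_le_pow₀ (by linarith)
    have h4 : (2 : ℝ) ^ k ≤ κ ^ k := pow_le_pow_left₀ (by norm_num) hκ2 k
    calc _ ≤ ((badSet k U W c).card : ℝ) * 2 ^ U.card := by
          apply mul_le_mul_of_nonneg_left _ hB
          nlinarith
      _ ≤ n.descFactorial k * 2 ^ n * 2 ^ (k + 2) := h1
      _ = 4 * 2 ^ k * ((n.descFactorial k : ℝ) * 2 ^ n) := by ring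
      _ ≤ _ := by
          apply mul_le_mul_of_nonneg_right _ hD
          linarith

theorem lower_bound (hn : 4 ≤ n) (hk : 4 ≤ k) (hkn : k ≤ n) (d : SAStyleDeriv (PV ERVar)
      (SARAxioms ERVar ((fun C => encodeIneqSAR C) '' ERPHP n k)) (-1)) :
    (n : ℝ) ^ k ≤ 4 * (2 * (k : ℝ) * Real.logb 2 (n : ℝ)) ^ k * d.size := by
  classical
  haveI : NeZero k := ⟨by omega⟩
  choose U W c hc hbad using fun t => line_ok hn hk (d.I t) (d.J t) (d.p t) (d.p_mem t)
  set κ := (2 * (k : ℝ) * Real.logb 2 (n : ℝ)) with hκ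
  have hcover : (Finset.univ : Finset ((Fin k ↪ Fin n) × (Fin n → Bool))) ⊆
      Finset.univ.biUnion (fun t => badSet k (U t) (W t) (c t)) := by
    intro z _
    obtain ⟨t, ht⟩ := exists_bad d z.1 z.2
    rw [Finset.mem_biUnion]
    refine ⟨t, Finset.mem_univ _, ?_⟩
    unfold badSet
    rw [Finset.mem_filter]
    exact ⟨Finset.mem_univ _, (hbad t z.1 z.2).resolve_left ht⟩
  have h1 := (Finset.card_le_card hcover).trans Finset.card_biUnion_le
  have h2 : (Finset.univ : Finset ((Fin k ↪ Fin n) × (Fin n → Bool))).card =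
      n.descFactorial k * 2 ^ n := by
    rw [Finset.card_univ, Fintype.card_prod, Fintype.card_embedding_eq]
    simp
  rw [h2] at h1
  have h3 : ((n.descFactorial k : ℝ) * 2 ^ n) ≤
      ∑ t, ((badSet k (U t) (W t) (c t)).card : ℝ) := by exact_mod_cast h1
  have hpos : (0 : ℝ) < (n.descFactorial k : ℝ) * 2 ^ n := by
    have : 0 < n.descFactorial k := Nat.descFactorial_pos.2 hkn
    positivity
  have h4 : ((n.descFactorial k : ℝ) * 2 ^ n) * (n : ℝ) ^ k ≤
      (d.len : ℝ) * (4 * κ ^ k * ((n.descFactorial k : ℝ) * 2 ^ n)) := by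
    calc _ ≤ (∑ t, ((badSet k (U t) (W t) (c t)).card : ℝ)) * (n : ℝ) ^ k :=
          mul_le_mul_of_nonneg_right h3 (by positivity)
      _ ≤ ∑ t : Fin d.len, (4 * κ ^ k * ((n.descFactorial k : ℝ) * 2 ^ n)) := by
          rw [Finset.sum_mul]
          exact Finset.sum_le_sum fun t _ => bad_real hn hk _ _ _ (hc t)
      _ = _ := by simp
  have h5 : (n : ℝ) ^ k ≤ 4 * κ ^ k * d.len := by
    refine le_of_mul_le_mul_left ?_ hpos
    linarith
  have h6 : (d.len : ℝ) ≤ d.size := by exact_mod_cast len_le_size hn hk d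
  have hlog : 0 ≤ Real.logb 2 (n : ℝ) :=
    Real.logb_nonneg (by norm_num) (by exact_mod_cast (by omega : 1 ≤ n))
  have h7 : 0 ≤ κ := by positivity
  refine h5.trans (mul_le_mul_of_nonneg_left h6 (by positivity))

theorem n_large (hk : 4 ≤ k) (h : (k : ℝ) ≤ (n : ℝ) / (4 * Real.logb 2 (n : ℝ))) :
    4 ≤ n ∧ k ≤ n ∧ 1 ≤ Real.logb 2 (n : ℝ) := by
  have hk' : (4 : ℝ) ≤ k := by exact_mod_cast hk
  have h2 : 2 ≤ n := by
    by_contra hc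
    have : n = 0 ∨ n = 1 := by omega
    rcases this with rfl | rfl <;> simp at h <;> omega
  have h2' : (2 : ℝ) ≤ n := by exact_mod_cast h2
  have hlog : 1 ≤ Real.logb 2 (n : ℝ) := by
    rw [Real.le_logb_iff_rpow_le (by norm_num) (by linarith)]
    simpa using h2'
  rw [le_div_iff₀ (by linarith)] at h
  have : (k : ℝ) ≤ n := by nlinarith
  have : k ≤ n := by exact_mod_cast this
  exact ⟨by omega, this, hlog⟩

end Lower2

/-- for every `k = k(n) ≥ 4` with `k ≤ n/(4·log₂ n)`, the
formula `ERPHP` has an SAR refutation of size at most `C·k^(k+2)·n^k` for an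
absolute constant `C`, and there exist `c > 0` and `n₀` such that for all
`n ≥ n₀` every SAR refutation of `ERPHP` has size at least
`c · n^k / (k · (16/15)^k · (2k·log₂ n)^k)`. -/
theorem sar_size_bounds_for_erphp :
    (∃ C : ℕ, 0 < C ∧ ∀ n k : ℕ, 4 ≤ k →
      (k : ℝ) ≤ (n : ℝ) / (4 * Real.logb 2 (n : ℝ)) →
      ∃ d : SAStyleDeriv (PV ERVar)
          (SARAxioms ERVar ((fun C => encodeIneqSAR C) '' ERPHP n k)) (-1),
        d.size ≤ C * k ^ (k + 2) * n ^ k) ∧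
    (∃ c : ℝ, 0 < c ∧ ∃ n₀ : ℕ, ∀ n k : ℕ,
      n₀ ≤ n → 4 ≤ k → (k : ℝ) ≤ (n : ℝ) / (4 * Real.logb 2 (n : ℝ)) →
      ∀ d : SAStyleDeriv (PV ERVar)
          (SARAxioms ERVar ((fun C => encodeIneqSAR C) '' ERPHP n k)) (-1),
        c * (n : ℝ) ^ k /
            ((k : ℝ) * (16 / 15 : ℝ) ^ k * (2 * (k : ℝ) * Real.logb 2 (n : ℝ)) ^ k)
          ≤ (d.size : ℝ)) := by
  refine ⟨⟨65, by norm_num, ?_⟩, ⟨1 / 4, by norm_num, 0, ?_⟩⟩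
  · intro n k hk h
    exact upper_bound (n_large hk h).1 hk
  · intro n k _ hk h d
    obtain ⟨h4, hkn, hlog⟩ := n_large hk h
    have hb := lower_bound h4 hk hkn d
    have hk' : (4 : ℝ) ≤ k := by exact_mod_cast hk
    have hpow : (1 : ℝ) ≤ (16 / 15 : ℝ) ^ k := one_le_pow₀ (by norm_num)
    have hκ : 0 < (2 * (k : ℝ) * Real.logb 2 (n : ℝ)) ^ k := by positivity
    have hone : 1 ≤ (k : ℝ) * (16 / 15 : ℝ) ^ k := by nlinarith
    rw [div_le_iff₀ (by positivity)]
    have hs : (0 : ℝ) ≤ d.size := by positivity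
    have h0 : 0 ≤ (2 * (k : ℝ) * Real.logb 2 (n : ℝ)) ^ k * d.size := by positivity
    nlinarith [mul_le_mul_of_nonneg_right hone h0]

end NarrowProofs
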